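/- Fix 1 ≤ i ≤ a1−1 and let π_i : M(r_{a2}) → M(s_i) be the morphism of representations which is the identity at every vertex in the support of M(s_i) and zero at all other vertices (this is a well-defined surjective morphism). Then for every vertex x of Q of the form r_j (0 ≤ j ≤ a2) or t_j (1 ≤ j ≤ a1−1), the linear map Hom(M(x), M(r_{a2})) → Hom(M(x), M(s_i)) given by f ↦ π_i ∘ f is an isomorphism of k-vector spaces. -/

import Mathlib

inductive V (a1 a2 : ℕ) : Type where
  | r : Fin (a2 + 1) → V a1 a2
  | s : Fin (a1 - 1) → V a1 a2
  | t : Fin (a1 - 1) → V a1 a2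

def Arrow (a1 a2 : ℕ) : V a1 a2 → V a1 a2 → Prop
  | .r i, .r j => ((i : ℕ) + 1 = (j : ℕ)) ∨ ((i : ℕ) = a2 ∧ (j : ℕ) = 0)
  | .s i, .s j => (i : ℕ) + 1 = (j : ℕ)
  | .s i, .r j => (i : ℕ) = a1 - 2 ∧ (j : ℕ) = a2
  | .r i, .t j => (i : ℕ) = 0 ∧ (j : ℕ) = 0
  | .t i, .t j => (i : ℕ) + 1 = (j : ℕ)
  | _, _ => False

structure Repn (k : Type) [Field k] (a1 a2 : ℕ) : Type 1 where
  carrier : V a1 a2 → Type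
  [acg : ∀ x, AddCommGroup (carrier x)]
  [mod : ∀ x, Module k (carrier x)]
  fd : ∀ x, FiniteDimensional k (carrier x)
  map : ∀ (x y : V a1 a2), Arrow a1 a2 x y → (carrier x →ₗ[k] carrier y)

attribute [instance] Repn.acg Repn.mod

def HomSpace {k : Type} [Field k] {a1 a2 : ℕ} (ρ σ : Repn k a1 a2) :
    Submodule k (∀ x : V a1 a2, ρ.carrier x →ₗ[k] σ.carrier x) where
  carrier := {f | ∀ (x y : V a1 a2) (h : Arrow a1 a2 x y),
      (σ.map x y h).comp (f x) = (f y).comp (ρ.map x y h)}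
  add_mem' := by
    intro f g hf hg
    intro x y h
    simp only [Pi.add_apply, LinearMap.comp_add, LinearMap.add_comp]
    rw [hf x y h, hg x y h]
  zero_mem' := by
    intro x y h
    simp
  smul_mem' := by
    intro c f hf
    intro x y h
    simp only [Pi.smul_apply, LinearMap.comp_smul, LinearMap.smul_comp]
    rw [hf x y h]

def IsSubrep {k : Type} [Field k] {a1 a2 : ℕ} (ρ : Repn k a1 a2)
    (N : ∀ x, Submodule k (ρ.carrier x)) : Prop :=
  ∀ (x y : V a1 a2) (h : Arrow a1 a2 x y), ∀ v ∈ N x, ρ.map x y h v ∈ N y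

open Classical in
noncomputable def sp (k : Type) [Field k] {a1 a2 : ℕ} (S : Set (V a1 a2)) (x : V a1 a2) :
    Submodule k k :=
  if x ∈ S then ⊤ else ⊥

open Classical in
noncomputable def thinMap (k : Type) [Field k] {a1 a2 : ℕ} (S T : Set (V a1 a2))
    (x y : V a1 a2) : (sp k S x) →ₗ[k] (sp k T y) where
  toFun v := if h : y ∈ T then ⟨(v : k), by simp [sp, h]⟩ else 0
  map_add' u v := by
    by_cases h : y ∈ T
    · simp only [dif_pos h]
      exact Subtype.ext (by simp)
    · simp [dif_neg h]
  map_smul' c v := by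
    by_cases h : y ∈ T
    · simp only [dif_pos h]
      exact Subtype.ext (by simp)
    · simp [dif_neg h]

noncomputable def thinRep (k : Type) [Field k] {a1 a2 : ℕ} (S : Set (V a1 a2)) :
    Repn k a1 a2 where
  carrier x := ↥(sp k S x)
  acg := fun _ => inferInstance
  mod := fun _ => inferInstance
  fd := fun _ => inferInstance
  map x y _ := thinMap k S S x y

def suppR (a1 a2 : ℕ) (i : ℕ) : Set (V a1 a2) :=
  {x | match x with
      | .r j => (j : ℕ) ≠ i
      | .s _ => i ≠ a2
      | .t _ => i ≠ 0}

def suppS (a1 a2 : ℕ) (i : ℕ) : Set (V a1 a2) :=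
  {x | match x with
      | .r j => (j : ℕ) < a2
      | .s _ => False
      | .t j => (j : ℕ) + 1 < i}

def suppT (a1 a2 : ℕ) (i : ℕ) : Set (V a1 a2) :=
  {x | match x with
      | .r j => 1 ≤ (j : ℕ)
      | .s j => i ≤ (j : ℕ)
      | .t _ => False}

noncomputable def Mr (k : Type) [Field k] (a1 a2 : ℕ) (i : ℕ) : Repn k a1 a2 :=
  thinRep k (suppR a1 a2 i)

noncomputable def Ms (k : Type) [Field k] (a1 a2 : ℕ) (i : ℕ) : Repn k a1 a2 :=
  thinRep k (suppS a1 a2 i)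

noncomputable def Mt (k : Type) [Field k] (a1 a2 : ℕ) (i : ℕ) : Repn k a1 a2 :=
  thinRep k (suppT a1 a2 i)

noncomputable def Mv (k : Type) [Field k] (a1 a2 : ℕ) : V a1 a2 → Repn k a1 a2
  | .r j => Mr k a1 a2 (j : ℕ)
  | .s j => Ms k a1 a2 ((j : ℕ) + 1)
  | .t j => Mt k a1 a2 ((j : ℕ) + 1)

/-- The canonical projection `π_i : M(r_{a2}) → M(s_i)`: the identity at every vertex of the
support of `M(s_i)` and zero at all other vertices. -/
noncomputable def proj (k : Type) [Field k] (a1 a2 : ℕ) (i : ℕ) :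
    ∀ x : V a1 a2, (Mr k a1 a2 a2).carrier x →ₗ[k] (Ms k a1 a2 i).carrier x :=
  fun x => thinMap k (suppR a1 a2 a2) (suppS a1 a2 i) x x

theorem sp_zero {k : Type} [Field k] {a1 a2 : ℕ} {S : Set (V a1 a2)} {x : V a1 a2}
    (h : x ∉ S) (v : sp k S x) : (v : k) = 0 := by
  have := v.2
  simpa [sp, h] using this

theorem thinMap_coe {k : Type} [Field k] {a1 a2 : ℕ} {S T : Set (V a1 a2)} {x y : V a1 a2}
    (h : y ∈ T) (v : sp k S x) : ((thinMap k S T x y v : sp k T y) : k) = v := by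
  simp [thinMap, h]

/-- scalar multiplication by `c` as a map of thin spaces -/
noncomputable def scal {k : Type} [Field k] {a1 a2 : ℕ} (S T : Set (V a1 a2)) (c : k)
    (x : V a1 a2) : sp k S x →ₗ[k] sp k T x := c • thinMap k S T x x

theorem scal_coe {k : Type} [Field k] {a1 a2 : ℕ} {S T : Set (V a1 a2)} {c : k}
    {x : V a1 a2} (h : x ∈ T) (v : sp k S x) : ((scal S T c x v : sp k T x) : k) = c * v := by
  simp [scal, thinMap_coe h]

theorem exists_scal {k : Type} [Field k] {a1 a2 : ℕ} {S T : Set (V a1 a2)} (x : V a1 a2)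
    (f : sp k S x →ₗ[k] sp k T x) : ∃ c : k, (x ∉ S → c = 0) ∧ (x ∉ T → c = 0) ∧
      ∀ v, ((f v : sp k T x) : k) = c * v := by
  by_cases hS : x ∈ S
  · have h1 : (1 : k) ∈ sp k S x := by simp [sp, hS]
    refine ⟨(f ⟨1, h1⟩ : sp k T x), fun h => absurd hS h, fun h => sp_zero h _, fun v => ?_⟩
    have : v = (v : k) • (⟨1, h1⟩ : sp k S x) := Subtype.ext (by simp)
    conv_lhs => rw [this, map_smul]
    simp [mul_comm]
  · refine ⟨0, fun _ => rfl, fun _ => rfl, fun v => ?_⟩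
    have : v = 0 := Subtype.ext (sp_zero hS v)
    simp [this]

/-- underlying scalar of an element of a thin space -/
abbrev tv {k : Type} [Field k] {a1 a2 : ℕ} (T : Set (V a1 a2)) (x : V a1 a2)
    (w : sp k T x) : k := w

theorem exists_scals {k : Type} [Field k] {a1 a2 : ℕ} {S T : Set (V a1 a2)}
    (f : HomSpace (thinRep k S) (thinRep k T)) :
    ∃ c : V a1 a2 → k, (∀ x, x ∉ S → c x = 0) ∧ (∀ x, x ∉ T → c x = 0) ∧
      (∀ x (v : sp k S x), tv T x (f.1 x v) = c x * v) ∧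
      ∀ x y, Arrow a1 a2 x y → x ∈ S → y ∈ T → c x = c y := by
  choose c h1 h2 h3 using fun x => exists_scal (k := k) (S := S) (T := T) x (f.1 x)
  refine ⟨c, h1, h2, h3, fun x y h hx hy => ?_⟩
  have h1' : (1 : k) ∈ sp k S x := by simp [sp, hx]
  have e : (thinMap k T T x y) (f.1 x (⟨1, h1'⟩ : sp k S x))
      = f.1 y (thinMap k S S x y (⟨1, h1'⟩ : sp k S x)) :=
    LinearMap.congr_fun (f.2 x y h) (⟨1, h1'⟩ : sp k S x)
  have e' := congrArg (fun w : sp k T y => (w : k)) e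
  have e1 := (thinMap_coe hy (f.1 x (⟨1, h1'⟩ : sp k S x))).symm.trans
    (e'.trans (h3 y _))
  have e2 := (h3 x ⟨1, h1'⟩).symm.trans e1
  by_cases hy' : y ∈ S
  · rw [thinMap_coe hy'] at e2
    simpa using e2
  · rw [sp_zero hy'] at e2
    rw [h1 y hy']
    simpa using e2

theorem scal_mem {k : Type} [Field k] {a1 a2 : ℕ} {S T : Set (V a1 a2)} (c : V a1 a2 → k)
    (h1 : ∀ x, x ∉ S → c x = 0) (h2 : ∀ x, x ∉ T → c x = 0)
    (h : ∀ x y, Arrow a1 a2 x y → x ∈ S → y ∈ T → c x = c y) :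
    (fun x => scal S T (c x) x) ∈ HomSpace (thinRep k S) (thinRep k T) := by
  intro x y hxy
  refine LinearMap.ext fun (v : sp k S x) => ?_
  change thinMap k T T x y (scal S T (c x) x v) = scal S T (c y) y (thinMap k S S x y v)
  apply Subtype.ext
  by_cases hy : y ∈ T
  · rw [thinMap_coe hy, scal_coe hy]
    by_cases hx : x ∈ S
    · have e1 : ((scal S T (c x) x v : sp k T x) : k) = c x * v := by
        by_cases hxT : x ∈ T
        · exact scal_coe hxT v
        · rw [sp_zero hxT, h2 x hxT, zero_mul]
      rw [e1, h x y hxy hx hy]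
      by_cases hyS : y ∈ S
      · rw [thinMap_coe hyS]
      · rw [h1 y hyS, zero_mul, zero_mul]
    · have : v = 0 := Subtype.ext (sp_zero hx v)
      simp [this]
  · rw [sp_zero hy, sp_zero hy]

/-- postcomposition with a morphism -/
noncomputable def postc {k : Type} [Field k] {a1 a2 : ℕ} {A B C : Repn k a1 a2}
    (p : HomSpace B C) : HomSpace A B →ₗ[k] HomSpace A C where
  toFun f := ⟨fun z => (p.1 z).comp (f.1 z), by
    intro x y h
    rw [← LinearMap.comp_assoc, p.2 x y h, LinearMap.comp_assoc, f.2 x y h,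
      LinearMap.comp_assoc]⟩
  map_add' f g := by
    apply Subtype.ext; funext z; exact LinearMap.comp_add _ _ _
  map_smul' c f := by
    apply Subtype.ext; funext z; exact LinearMap.comp_smul _ _ _

theorem suppS_sub {a1 a2 i : ℕ} (ha2 : 0 < a2) (x : V a1 a2) (h : x ∈ suppS a1 a2 i) :
    x ∈ suppR a1 a2 a2 := by
  cases x <;> simp_all [suppS, suppR] <;> omega

theorem proj_mem (k : Type) [Field k] (a1 a2 i : ℕ) (ha2 : 0 < a2) :
    proj k a1 a2 i ∈ HomSpace (Mr k a1 a2 a2) (Ms k a1 a2 i) := by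
  intro x y hxy
  refine LinearMap.ext fun (v : sp k (suppR a1 a2 a2) x) => ?_
  change thinMap k (suppS a1 a2 i) (suppS a1 a2 i) x y
      (thinMap k (suppR a1 a2 a2) (suppS a1 a2 i) x x v) =
    thinMap k (suppR a1 a2 a2) (suppS a1 a2 i) y y
      (thinMap k (suppR a1 a2 a2) (suppR a1 a2 a2) x y v)
  apply Subtype.ext
  by_cases hy : y ∈ suppS a1 a2 i
  · rw [thinMap_coe hy, thinMap_coe hy, thinMap_coe (suppS_sub ha2 y hy)]
    by_cases hx : x ∈ suppS a1 a2 i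
    · rw [thinMap_coe hx]
    · rw [sp_zero hx, sp_zero]
      intro hx'
      cases x <;> cases y <;> simp_all [suppS, suppR, Arrow] <;> omega
  · rw [sp_zero hy, sp_zero hy]

theorem proj_surj (k : Type) [Field k] (a1 a2 i : ℕ) (ha2 : 0 < a2) (x : V a1 a2) :
    Function.Surjective (proj k a1 a2 i x) := by
  intro (w : sp k (suppS a1 a2 i) x)
  refine ⟨thinMap k (suppS a1 a2 i) (suppR a1 a2 a2) x x w, ?_⟩
  change thinMap k (suppR a1 a2 a2) (suppS a1 a2 i) x x _ = w
  apply Subtype.ext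
  by_cases hx : x ∈ suppS a1 a2 i
  · rw [thinMap_coe hx, thinMap_coe (suppS_sub ha2 x hx)]
  · rw [sp_zero hx, sp_zero hx]

theorem c_t {k : Type} [Field k] {a1 a2 : ℕ} {S T : Set (V a1 a2)} (c : V a1 a2 → k)
    (hS : ∀ j, V.t j ∈ S ↔ V.r 0 ∈ S) (h1 : ∀ x, x ∉ S → c x = 0)
    (h : ∀ x y, Arrow a1 a2 x y → x ∈ S → y ∈ T → c x = c y) (n : ℕ) (hn : n < a1 - 1)
    (hT : ∀ m (hm : m < a1 - 1), m ≤ n → V.t ⟨m, hm⟩ ∈ T) :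
    c (V.t ⟨n, hn⟩) = c (V.r 0) := by
  by_cases h0 : V.r 0 ∈ S
  · induction n with
    | zero => exact (h _ _ (by simp [Arrow]) h0 (hT 0 hn le_rfl)).symm
    | succ n ih =>
      rw [← ih (by omega) (fun m hm hmn => hT m hm (by omega))]
      exact (h _ _ (by simp [Arrow]) ((hS _).2 h0) (hT _ hn le_rfl)).symm
  · rw [h1 _ h0, h1 _ (fun hh => h0 ((hS _).1 hh))]

theorem main_bij (k : Type) [Field k] (a1 a2 i : ℕ) (ha2 : 0 < a2) (S : Set (V a1 a2))
    (hS : ∀ j, V.t j ∈ S ↔ V.r 0 ∈ S) :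
    ∃ e : ↥(HomSpace (thinRep k S) (Mr k a1 a2 a2)) ≃ₗ[k]
            ↥(HomSpace (thinRep k S) (Ms k a1 a2 i)),
        ∀ (f : ↥(HomSpace (thinRep k S) (Mr k a1 a2 a2))) (z : V a1 a2),
          (e f).1 z = (proj k a1 a2 i z).comp (f.1 z) := by
  have key : Function.Bijective
      (postc (A := thinRep k S) ⟨proj k a1 a2 i, proj_mem k a1 a2 i ha2⟩) := by
    constructor
    · rw [injective_iff_map_eq_zero]
      intro f hf
      obtain ⟨c, h1, h2, h3, h4⟩ :=
        exists_scals (k := k) (S := S) (T := suppR a1 a2 a2) f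
      have hc : ∀ z, z ∈ suppS a1 a2 i → c z = 0 := by
        intro z hz
        by_cases hzS : z ∈ S
        · have h1' : (1 : k) ∈ sp k S z := by simp [sp, hzS]
          have e : thinMap k (suppR a1 a2 a2) (suppS a1 a2 i) z z
              (f.1 z (⟨1, h1'⟩ : sp k S z)) = 0 :=
            LinearMap.congr_fun (congrFun (congrArg Subtype.val hf) z) (⟨1, h1'⟩ : sp k S z)
          have e' := congrArg (fun w : sp k (suppS a1 a2 i) z => (w : k)) e
          have e2 := (h3 z ⟨1, h1'⟩).symm.trans ((thinMap_coe hz _).symm.trans e')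
          simpa using e2
        · exact h1 z hzS
      have hc' : ∀ z, c z = 0 := by
        intro z
        cases z with
        | r j =>
          by_cases hj : (j : ℕ) < a2
          · exact hc _ hj
          · apply h2
            have := j.2
            simp [suppR]; omega
        | s j => apply h2; simp [suppR]
        | t j =>
          rw [c_t c hS h1 h4 j.1 j.2 (fun m hm _ => by simp [suppR]; omega)]
          exact hc _ (by simpa [suppS] using ha2)
      apply Subtype.ext
      funext z
      refine LinearMap.ext fun (v : sp k S z) => ?_
      apply Subtype.ext
      refine (h3 z v).trans ?_
      rw [hc' z, zero_mul]; rfl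
    · intro g
      obtain ⟨c, h1, h2, h3, h4⟩ :=
        exists_scals (k := k) (S := S) (T := suppS a1 a2 i) g
      let c' : V a1 a2 → k := fun z => match z with
        | .r j => c (.r j)
        | .s j => c (.s j)
        | .t _ => c (.r 0)
      have hm := scal_mem (S := S) (T := suppR a1 a2 a2) c'
        (by
          intro x hx
          cases x with
          | r j => exact h1 _ hx
          | s j => exact h1 _ hx
          | t j => exact h1 _ (fun h => hx ((hS j).2 h)))
        (by
          intro x hx
          cases x with
          | r j => exact h2 _ (fun h => hx (suppS_sub ha2 _ h))
          | s j => exact h2 _ (fun h => hx (suppS_sub ha2 _ h))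
          | t j => exact absurd (by simp [suppR]; omega) hx)
        (by
          intro x y hxy hx hy
          cases x <;> cases y <;> try exact hxy.elim
          · rename_i p q
            refine h4 _ _ hxy hx ?_
            have := q.2
            simp [suppS, suppR] at hy ⊢; omega
          · rename_i p q
            have : p = 0 := Fin.ext hxy.1
            subst this; rfl
          · simp [Arrow, suppR] at hxy hy; omega
          · simp [suppR] at hy
          · rfl)
      refine ⟨⟨_, hm⟩, ?_⟩
      apply Subtype.ext
      funext z
      refine LinearMap.ext fun (v : sp k S z) => ?_
      apply Subtype.ext
      refine Eq.trans ?_ (h3 z v).symm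
      change ((thinMap k (suppR a1 a2 a2) (suppS a1 a2 i) z z
        (scal S (suppR a1 a2 a2) (c' z) z v) : sp k (suppS a1 a2 i) z) : k) = _
      by_cases hz : z ∈ suppS a1 a2 i
      · rw [thinMap_coe hz, scal_coe (suppS_sub ha2 z hz)]
        congr 1
        cases z with
        | r j => rfl
        | s j => rfl
        | t j =>
          refine (c_t c hS h1 h4 j.1 j.2 (fun m hm hmn => ?_)).symm
          simp [suppS] at hz ⊢; omega
      · rw [sp_zero hz, h2 z hz, zero_mul]
  exact ⟨LinearEquiv.ofBijective _ key, fun f z => rfl⟩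

/-- Fix `1 ≤ i ≤ a1 - 1` and let `π_i : M(r_{a2}) → M(s_i)` be the morphism of
representations which is the identity at every vertex of the support of `M(s_i)` and zero
elsewhere; it is a well-defined surjective morphism.  Then for every vertex `x` of the form
`r_j` or `t_j`, the linear map `Hom(M(x), M(r_{a2})) → Hom(M(x), M(s_i))`, `f ↦ π_i ∘ f`,
is an isomorphism of `k`-vector spaces. -/
theorem statement13 (k : Type) [Field k] (a1 a2 : ℕ) (ha1 : 0 < a1) (ha2 : 0 < a2)
    (i : ℕ) (hi1 : 1 ≤ i) (hi2 : i ≤ a1 - 1) :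
    proj k a1 a2 i ∈ HomSpace (Mr k a1 a2 a2) (Ms k a1 a2 i) ∧
    (∀ x : V a1 a2, Function.Surjective (proj k a1 a2 i x)) ∧
    (∀ x : V a1 a2, ((∃ j, x = V.r j) ∨ (∃ j, x = V.t j)) →
      ∃ e : ↥(HomSpace (Mv k a1 a2 x) (Mr k a1 a2 a2)) ≃ₗ[k]
            ↥(HomSpace (Mv k a1 a2 x) (Ms k a1 a2 i)),
        ∀ (f : ↥(HomSpace (Mv k a1 a2 x) (Mr k a1 a2 a2))) (z : V a1 a2),
          (e f).1 z = (proj k a1 a2 i z).comp (f.1 z)) := by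
  refine ⟨proj_mem k a1 a2 i ha2, proj_surj k a1 a2 i ha2, ?_⟩
  rintro x (⟨j, rfl⟩ | ⟨j, rfl⟩)
  · exact main_bij k a1 a2 i ha2 (suppR a1 a2 j) (fun l => by simp [suppR, eq_comm])
  · exact main_bij k a1 a2 i ha2 (suppT a1 a2 (j + 1)) (fun l => by simp [suppT])
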